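/- For temporary exchange instances with four agents, there exists no mechanism that is core-consistent and strategyproof. That is, there is no function f mapping each preference profile (a total preorder over N × N for each of the four agents) to an allocation, such that f returns a core stable allocation whenever one exists, and no agent i can ever obtain a strictly preferred outcome (with respect to her true preference) by reporting a different preference relation. -/

import Mathlib

open scoped Classical

/-- The outcome of agent `i` under allocation `σ`: the owner of the house `i` receives,
and the tenant who receives `i`'s own house. -/
def outcome {N : Type*} (σ : Equiv.Perm N) (i : N) : N × N := (σ i, σ.symm i)

/-- Strict preference derived from a weak preference relation `r`. -/
def SPref {α : Type*} (r : α → α → Prop) (a b : α) : Prop := r a b ∧ ¬ r b a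

/-- `r` is a total preorder: total and transitive. -/
def TotalPreorderRel {α : Type*} (r : α → α → Prop) : Prop :=
  (∀ a b, r a b ∨ r b a) ∧ (∀ a b c, r a b → r b c → r a c)

/-- A nonempty coalition `S` blocks allocation `σ`: there is a permutation `τ` of `S`
(fixing all agents outside `S`) under which every member of `S` is strictly better off. -/
def Blocks {N : Type*} (pref : N → (N × N) → (N × N) → Prop)
    (σ : Equiv.Perm N) (S : Set N) : Prop :=
  S.Nonempty ∧ ∃ τ : Equiv.Perm N, (∀ i ∉ S, τ i = i) ∧
    ∀ i ∈ S, SPref (pref i) (outcome τ i) (outcome σ i)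

/-- An allocation is core stable if no coalition blocks it. -/
def CoreStable {N : Type*} (pref : N → (N × N) → (N × N) → Prop) (σ : Equiv.Perm N) : Prop :=
  ∀ S : Set N, ¬ Blocks pref σ S

/-- The value of an outcome to an agent who only accepts bilateral swaps (or keeping her own
house), valuing agent `j` as a swap partner at `v j`. -/
def swapValue (v : Fin 4 → ℕ) (p : Fin 4 × Fin 4) : ℕ := if p.1 = p.2 then v p.1 else 0

/-- The preference relation represented by `swapValue v`. -/
def swapPref (v : Fin 4 → ℕ) (p q : Fin 4 × Fin 4) : Prop := swapValue v q ≤ swapValue v p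

theorem totalPreorderRel_swapPref (v : Fin 4 → ℕ) : TotalPreorderRel (swapPref v) :=
  ⟨fun _ _ => le_total _ _, fun _ _ _ hab hbc => le_trans hbc hab⟩

theorem sPref_swapPref_iff {v : Fin 4 → ℕ} {p q : Fin 4 × Fin 4} :
    SPref (swapPref v) p q ↔ swapValue v q < swapValue v p :=
  lt_iff_le_not_ge.symm

/-- A coalition blocks iff some reallocation strictly improves someone and everyone it moves. -/
theorem coreStable_iff {N : Type*} {pref : N → N × N → N × N → Prop} {σ : Equiv.Perm N} :
    CoreStable pref σ ↔ ∀ τ : Equiv.Perm N,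
      ¬ ((∃ i, SPref (pref i) (outcome τ i) (outcome σ i)) ∧
        ∀ i, τ i = i ∨ SPref (pref i) (outcome τ i) (outcome σ i)) := by
  constructor
  · rintro h τ ⟨⟨i, hi⟩, hτ⟩
    exact h {j | SPref (pref j) (outcome τ j) (outcome σ j)}
      ⟨⟨i, hi⟩, τ, fun j hj => (hτ j).resolve_right hj, fun _ hj => hj⟩
  · rintro h S ⟨⟨i, hi⟩, τ, hfix, himp⟩
    refine h τ ⟨⟨i, himp i hi⟩, fun j => ?_⟩
    by_cases hj : j ∈ S
    · exact Or.inr (himp j hj)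
    · exact Or.inl (hfix j hj)

theorem coreStable_swapPref_iff {V : Fin 4 → Fin 4 → ℕ} {σ : Equiv.Perm (Fin 4)} :
    CoreStable (fun i => swapPref (V i)) σ ↔ ∀ τ : Equiv.Perm (Fin 4),
      ¬ ((∃ i, swapValue (V i) (outcome σ i) < swapValue (V i) (outcome τ i)) ∧
        ∀ i, τ i = i ∨ swapValue (V i) (outcome σ i) < swapValue (V i) (outcome τ i)) := by
  simp only [coreStable_iff, sPref_swapPref_iff]

theorem update_swapPref (V : Fin 4 → Fin 4 → ℕ) (i : Fin 4) (v : Fin 4 → ℕ) :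
    Function.update (fun j => swapPref (V j)) i (swapPref v) =
      fun j => swapPref (Function.update V i v j) := by
  ext1 j
  exact (Function.apply_update (fun _ => swapPref) V i v j).symm

/-- A marriage market between agents `0, 1` and agents `2, 3` in which the two sides disagree
about the best stable matching. -/
def marketValues : Fin 4 → Fin 4 → ℕ :=
  ![![1, 0, 3, 2], ![0, 1, 2, 3], ![2, 3, 1, 0], ![3, 2, 0, 1]]

/-- The stable matching preferred by agents `0` and `1`. -/
def leftOptimal : Equiv.Perm (Fin 4) := Equiv.swap 0 2 * Equiv.swap 1 3

/-- The stable matching preferred by agents `2` and `3`. -/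
def rightOptimal : Equiv.Perm (Fin 4) := Equiv.swap 0 3 * Equiv.swap 1 2

theorem coreStable_market_iff {σ : Equiv.Perm (Fin 4)} :
    CoreStable (fun i => swapPref (marketValues i)) σ ↔ σ = leftOptimal ∨ σ = rightOptimal := by
  rw [coreStable_swapPref_iff]
  revert σ
  decide +kernel

/-- If agent `0` declares agent `3` unacceptable, only `leftOptimal` is core stable. -/
theorem coreStable_left_truncation_iff {σ : Equiv.Perm (Fin 4)} :
    CoreStable (fun i => swapPref (Function.update marketValues 0 ![1, 0, 3, 0] i)) σ ↔
      σ = leftOptimal := by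
  rw [coreStable_swapPref_iff]
  revert σ
  decide +kernel

/-- If agent `2` declares agent `0` unacceptable, only `rightOptimal` is core stable. -/
theorem coreStable_right_truncation_iff {σ : Equiv.Perm (Fin 4)} :
    CoreStable (fun i => swapPref (Function.update marketValues 2 ![0, 3, 1, 0] i)) σ ↔
      σ = rightOptimal := by
  rw [coreStable_swapPref_iff]
  revert σ
  decide +kernel

/-- for temporary exchange instances with four agents, there is no
core-consistent and strategyproof mechanism. -/
theorem no_core_consistent_SP_mechanism :
    ¬ ∃ f : (Fin 4 → (Fin 4 × Fin 4) → (Fin 4 × Fin 4) → Prop) → Equiv.Perm (Fin 4),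
      (∀ pref, (∀ i, TotalPreorderRel (pref i)) →
          (∃ σ : Equiv.Perm (Fin 4), CoreStable pref σ) → CoreStable pref (f pref)) ∧
      (∀ pref, (∀ i, TotalPreorderRel (pref i)) →
        ∀ (i : Fin 4) (r' : (Fin 4 × Fin 4) → (Fin 4 × Fin 4) → Prop),
          TotalPreorderRel r' →
          ¬ SPref (pref i) (outcome (f (Function.update pref i r')) i)
              (outcome (f pref) i)) := by
  rintro ⟨f, hcore, hsp⟩
  have stable (V : Fin 4 → Fin 4 → ℕ) :=
    hcore (fun i => swapPref (V i)) fun i => totalPreorderRel_swapPref (V i)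
  have truthful (i : Fin 4) (v : Fin 4 → ℕ) :=
    hsp _ (fun j => totalPreorderRel_swapPref (marketValues j)) i _ (totalPreorderRel_swapPref v)
  simp only [update_swapPref, sPref_swapPref_iff] at truthful
  have hleft := coreStable_left_truncation_iff.1
    (stable _ ⟨_, coreStable_left_truncation_iff.2 rfl⟩)
  have hright := coreStable_right_truncation_iff.1
    (stable _ ⟨_, coreStable_right_truncation_iff.2 rfl⟩)
  rcases coreStable_market_iff.1 (stable _ ⟨_, coreStable_market_iff.2 (Or.inl rfl)⟩) with h | h
  · refine truthful 2 ![0, 3, 1, 0] ?_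
    rw [h, hright]
    decide
  · refine truthful 0 ![1, 0, 3, 0] ?_
    rw [h, hleft]
    decide
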